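/- Let m > 0 and ξ ∈ ℝ³, let E := √(m² + |ξ|²), and let b ∈ ℝ^{3×3} be antisymmetric (b_{lj} = −b_{jl}). For l ∈ {1,2,3} set D_l(ξ) := − (m ξ_l)/(2√2 · E^{5/2} (E+m)^{1/2}) · I₄ + (ξ_l (2E+m))/(2√2 · E^{5/2} (E+m)^{3/2}) · (ξ·α)β − (2E(E+m))^{-1/2} · α_l β (this is ∂_{ξ_l} u₀(ξ); moreover ∂_{ξ_j} H₀(ξ) = α_j and ∂_{ξ_l}(Eβ) = (ξ_l/E)β). Then the magnetic-moment (spin) term of the effective semirelativistic Hamiltonian satisfies the 4×4 matrix identity (i/2) Σ_{l,j=1}^3 b_{lj} · π_ref ( D_l(ξ) α_j − (ξ_l/E) β D_j(ξ) ) u₀(ξ)* π_ref = −(1/(2E)) · M, where M is the 4×4 matrix whose upper-left 2×2 block is w·σ := Σ_{k=1}^3 w_k σ_k with w_k := (1/2) Σ_{l,j=1}^3 ε_{klj} b_{lj} (ε the Levi-Civita symbol), and whose remaining entries are zero. -/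

import Mathlib

noncomputable section
open Complex Matrix

/-- The Pauli matrices `σ₁, σ₂, σ₃`. -/
def pauli : Fin 3 → Matrix (Fin 2) (Fin 2) ℂ :=
  ![!![0, 1; 1, 0], !![0, -Complex.I; Complex.I, 0], !![1, 0; 0, -1]]

/-- The Dirac matrices `α_j = [[0, σ_j],[σ_j, 0]]` in 2×2 block form. -/
def diracAlpha (j : Fin 3) : Matrix (Fin 4) (Fin 4) ℂ :=
  Matrix.reindex finSumFinEquiv finSumFinEquiv
    (Matrix.fromBlocks 0 (pauli j) (pauli j) 0)

/-- The Dirac matrix `β = diag(1,1,-1,-1)`. -/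
def diracBeta : Matrix (Fin 4) (Fin 4) ℂ :=
  Matrix.reindex finSumFinEquiv finSumFinEquiv
    (Matrix.fromBlocks (1 : Matrix (Fin 2) (Fin 2) ℂ) 0 0
      (-1 : Matrix (Fin 2) (Fin 2) ℂ))

/-- The reference projection `π_ref = diag(1,1,0,0)`. -/
def piRef : Matrix (Fin 4) (Fin 4) ℂ :=
  Matrix.reindex finSumFinEquiv finSumFinEquiv
    (Matrix.fromBlocks (1 : Matrix (Fin 2) (Fin 2) ℂ) 0 0
      (0 : Matrix (Fin 2) (Fin 2) ℂ))

/-- `ξ·α := Σ_j ξ_j α_j`. -/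
def xiDotAlpha (ξ : Fin 3 → ℝ) : Matrix (Fin 4) (Fin 4) ℂ :=
  ∑ j, (ξ j : ℂ) • diracAlpha j

/-- The free Dirac Hamiltonian symbol `H₀(ξ) := mβ + ξ·α`. -/
def diracH0 (m : ℝ) (ξ : Fin 3 → ℝ) : Matrix (Fin 4) (Fin 4) ℂ :=
  (m : ℂ) • diracBeta + xiDotAlpha ξ

/-- The relativistic dispersion `E := √(m² + |ξ|²)`. -/
def Ed (m : ℝ) (ξ : Fin 3 → ℝ) : ℝ := Real.sqrt (m ^ 2 + ∑ j, ξ j ^ 2)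

/-- The Foldy–Wouthuysen unitary `u₀(ξ) := (2E(E+m))^{-1/2} ((E+m) I₄ - (ξ·α)β)`. -/
def u0 (m : ℝ) (ξ : Fin 3 → ℝ) : Matrix (Fin 4) (Fin 4) ℂ :=
  (((Real.sqrt (2 * Ed m ξ * (Ed m ξ + m)))⁻¹ : ℝ) : ℂ) •
    (((Ed m ξ + m : ℝ) : ℂ) • (1 : Matrix (Fin 4) (Fin 4) ℂ) - xiDotAlpha ξ * diracBeta)

/-- The matrix `D_l(ξ) = ∂_{ξ_l}u₀(ξ)`:
`D_l = -(mξ_l)/(2√2 E^{5/2}(E+m)^{1/2}) I₄ + (ξ_l(2E+m))/(2√2 E^{5/2}(E+m)^{3/2}) (ξ·α)β - (2E(E+m))^{-1/2} α_l β`. -/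
def Dmat (m : ℝ) (ξ : Fin 3 → ℝ) (l : Fin 3) : Matrix (Fin 4) (Fin 4) ℂ :=
  ((-(m * ξ l) / (2 * Real.sqrt 2 * Ed m ξ ^ ((5:ℝ)/2) * (Ed m ξ + m) ^ ((1:ℝ)/2)) : ℝ) : ℂ) •
      (1 : Matrix (Fin 4) (Fin 4) ℂ)
    + ((ξ l * (2 * Ed m ξ + m) / (2 * Real.sqrt 2 * Ed m ξ ^ ((5:ℝ)/2) * (Ed m ξ + m) ^ ((3:ℝ)/2)) : ℝ) : ℂ) •
      (xiDotAlpha ξ * diracBeta)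
    - (((Real.sqrt (2 * Ed m ξ * (Ed m ξ + m)))⁻¹ : ℝ) : ℂ) • (diracAlpha l * diracBeta)

/-- The totally antisymmetric Levi-Civita symbol on `Fin 3` with `ε₁₂₃ = 1`. -/
def levi (k l j : Fin 3) : ℝ :=
  if (k, l, j) = (0, 1, 2) ∨ (k, l, j) = (1, 2, 0) ∨ (k, l, j) = (2, 0, 1) then 1
  else if (k, l, j) = (0, 2, 1) ∨ (k, l, j) = (2, 1, 0) ∨ (k, l, j) = (1, 0, 2) then -1
  else 0

/-- `ξ·σ := Σ_j ξ_j σ_j`. -/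
def xiDotSigma (ξ : Fin 3 → ℝ) : Matrix (Fin 2) (Fin 2) ℂ :=
  ∑ j, (ξ j : ℂ) • pauli j

/-- The `4×4` matrix with the given `2×2` blocks. -/
def blocks (A B C D : Matrix (Fin 2) (Fin 2) ℂ) : Matrix (Fin 4) (Fin 4) ℂ :=
  Matrix.reindex finSumFinEquiv finSumFinEquiv (Matrix.fromBlocks A B C D)

lemma blocks_mul (A B C D A' B' C' D' : Matrix (Fin 2) (Fin 2) ℂ) :
    blocks A B C D * blocks A' B' C' D' =
      blocks (A * A' + B * C') (A * B' + B * D') (C * A' + D * C') (C * B' + D * D') := by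
  simp only [blocks, reindex_apply]
  rw [submatrix_mul_equiv, fromBlocks_multiply]

lemma blocks_add (A B C D A' B' C' D' : Matrix (Fin 2) (Fin 2) ℂ) :
    blocks A B C D + blocks A' B' C' D' = blocks (A + A') (B + B') (C + C') (D + D') := by
  simp only [blocks, reindex_apply, ← fromBlocks_add]
  rfl

lemma blocks_sub (A B C D A' B' C' D' : Matrix (Fin 2) (Fin 2) ℂ) :
    blocks A B C D - blocks A' B' C' D' = blocks (A - A') (B - B') (C - C') (D - D') := by
  rw [sub_eq_iff_eq_add, blocks_add]
  simp only [sub_add_cancel]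

lemma smul_blocks (r : ℂ) (A B C D : Matrix (Fin 2) (Fin 2) ℂ) :
    r • blocks A B C D = blocks (r • A) (r • B) (r • C) (r • D) := by
  simp only [blocks, reindex_apply, ← fromBlocks_smul]
  rfl

lemma blocks_conjTranspose (A B C D : Matrix (Fin 2) (Fin 2) ℂ) :
    (blocks A B C D)ᴴ = blocks Aᴴ Cᴴ Bᴴ Dᴴ := by
  simp only [blocks, conjTranspose_reindex, fromBlocks_conjTranspose]

lemma one_eq_blocks : (1 : Matrix (Fin 4) (Fin 4) ℂ) = blocks 1 0 0 1 := by
  simp [blocks]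

lemma sum_blocks_zero {ι : Type*} (s : Finset ι) (A : ι → Matrix (Fin 2) (Fin 2) ℂ) :
    ∑ i ∈ s, blocks (A i) 0 0 0 = blocks (∑ i ∈ s, A i) 0 0 0 := by
  classical
  induction s using Finset.induction_on with
  | empty => simp [blocks]
  | insert a s ha ih => rw [Finset.sum_insert ha, Finset.sum_insert ha, ih, blocks_add]; simp

lemma diracAlpha_eq_blocks (j : Fin 3) : diracAlpha j = blocks 0 (pauli j) (pauli j) 0 := rfl

lemma diracBeta_eq_blocks : diracBeta = blocks 1 0 0 (-1) := rfl

lemma piRef_eq_blocks : piRef = blocks 1 0 0 0 := rfl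

lemma xiDotAlpha_eq_blocks (ξ : Fin 3 → ℝ) :
    xiDotAlpha ξ = blocks 0 (xiDotSigma ξ) (xiDotSigma ξ) 0 := by
  simp only [xiDotAlpha, xiDotSigma, Fin.sum_univ_three, diracAlpha_eq_blocks, smul_blocks,
    blocks_add, smul_zero, add_zero]

lemma xiDotSigma_conjTranspose (ξ : Fin 3 → ℝ) : (xiDotSigma ξ)ᴴ = xiDotSigma ξ := by
  ext i j
  fin_cases i <;> fin_cases j <;> simp [xiDotSigma, Fin.sum_univ_three, pauli]

lemma Ed_pos {m : ℝ} (hm : 0 < m) (ξ : Fin 3 → ℝ) : 0 < Ed m ξ :=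
  Real.sqrt_pos.2 (by positivity)

lemma u0_conjTranspose (m : ℝ) (ξ : Fin 3 → ℝ) :
    (u0 m ξ)ᴴ = (((Real.sqrt (2 * Ed m ξ * (Ed m ξ + m)))⁻¹ : ℝ) : ℂ) •
      blocks (((Ed m ξ + m : ℝ) : ℂ) • 1) (-xiDotSigma ξ) (xiDotSigma ξ)
        (((Ed m ξ + m : ℝ) : ℂ) • 1) := by
  simp only [u0, xiDotAlpha_eq_blocks, diracBeta_eq_blocks, one_eq_blocks, blocks_mul,
    smul_blocks, blocks_sub, blocks_conjTranspose]
  simp [xiDotSigma_conjTranspose]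

lemma rpow_five_halves_mul_rpow_half {x y : ℝ} (hx : 0 < x) :
    2 * Real.sqrt 2 * x ^ ((5 : ℝ) / 2) * y ^ ((1 : ℝ) / 2) =
      2 * x ^ 2 * Real.sqrt (2 * x * y) := by
  have h : x ^ ((5 : ℝ) / 2) = x ^ 2 * Real.sqrt x := by
    rw [Real.sqrt_eq_rpow, ← Real.rpow_natCast, ← Real.rpow_add hx]
    norm_num
  rw [h, ← Real.sqrt_eq_rpow, Real.sqrt_mul (by positivity), Real.sqrt_mul (by positivity)]
  ring

lemma rpow_five_halves_mul_rpow_three_halves {x y : ℝ} (hx : 0 < x) (hy : 0 < y) :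
    2 * Real.sqrt 2 * x ^ ((5 : ℝ) / 2) * y ^ ((3 : ℝ) / 2) =
      2 * x ^ 2 * y * Real.sqrt (2 * x * y) := by
  have h : y ^ ((3 : ℝ) / 2) = y * y ^ ((1 : ℝ) / 2) := by
    nth_rw 2 [← Real.rpow_one y]
    rw [← Real.rpow_add hy]
    norm_num
  rw [h]
  linear_combination y * rpow_five_halves_mul_rpow_half (y := y) hx

lemma Dmat_eq_blocks {m : ℝ} (hm : 0 < m) (ξ : Fin 3 → ℝ) (l : Fin 3) {p q : ℂ}
    (hp : p = ((-(m * ξ l) / (2 * Ed m ξ ^ 2) : ℝ) : ℂ))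
    (hq : q = ((ξ l * (2 * Ed m ξ + m) / (2 * Ed m ξ ^ 2 * (Ed m ξ + m)) : ℝ) : ℂ)) :
    Dmat m ξ l = (((Real.sqrt (2 * Ed m ξ * (Ed m ξ + m)))⁻¹ : ℝ) : ℂ) •
      blocks (p • 1) (pauli l - q • xiDotSigma ξ) (q • xiDotSigma ξ - pauli l) (p • 1) := by
  have hE := Ed_pos hm ξ
  rw [Dmat, rpow_five_halves_mul_rpow_half hE,
    rpow_five_halves_mul_rpow_three_halves hE (by positivity),
    ← div_div, ← div_div _ _ (Real.sqrt _), div_eq_inv_mul _ (Real.sqrt _),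
    div_eq_inv_mul _ (Real.sqrt _),
    Complex.ofReal_mul, Complex.ofReal_mul, ← hp, ← hq, mul_smul, mul_smul, ← smul_add, ← smul_sub]
  congr 1
  simp only [xiDotAlpha_eq_blocks, diracAlpha_eq_blocks, diracBeta_eq_blocks, one_eq_blocks,
    blocks_mul, smul_blocks, blocks_add, blocks_sub]
  congr 1 <;> simp
  abel

lemma xiDotSigma_mul_pauli_add (ξ : Fin 3 → ℝ) (j : Fin 3) :
    xiDotSigma ξ * pauli j + pauli j * xiDotSigma ξ = (2 * ξ j : ℂ) • 1 := by
  ext a c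
  fin_cases j <;> fin_cases a <;> fin_cases c <;>
    simp [xiDotSigma, Fin.sum_univ_three, pauli] <;> ring_nf <;> simp

/-- The summand of the spin term is, in its only nonzero block, `σ_l σ_j / (2E)` plus `ξ_l ξ_j`
times a matrix that does not depend on `l` and `j`. -/
lemma piRef_mul_summand_mul_piRef {m : ℝ} (hm : 0 < m) (ξ : Fin 3 → ℝ) (l j : Fin 3) :
    piRef * (Dmat m ξ l * diracAlpha j
        - ((ξ l / Ed m ξ : ℝ) : ℂ) • (diracBeta * Dmat m ξ j)) * (u0 m ξ)ᴴ * piRef =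
      blocks ((2 * Ed m ξ : ℂ)⁻¹ • (pauli l * pauli j) +
        (ξ l * ξ j : ℂ) • (2 * Ed m ξ * (Ed m ξ + m) : ℂ)⁻¹ •
          ((m * (Ed m ξ + m) / (2 * Ed m ξ ^ 3) - (2 * Ed m ξ + m) / Ed m ξ ^ 2 : ℂ) • 1 +
            ((2 * Ed m ξ + m) / (2 * Ed m ξ ^ 3 * (Ed m ξ + m)) : ℂ) •
              (xiDotSigma ξ * xiDotSigma ξ))) 0 0 0 := by
  have hE := Ed_pos hm ξ
  have hEc : (Ed m ξ : ℂ) ≠ 0 := by exact_mod_cast hE.ne'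
  have hEm : (Ed m ξ + m : ℂ) ≠ 0 := by exact_mod_cast (add_pos hE hm).ne'
  have hc : (((Real.sqrt (2 * Ed m ξ * (Ed m ξ + m)))⁻¹ : ℝ) : ℂ) ^ 2 *
      (2 * Ed m ξ * (Ed m ξ + m)) = 1 := by
    have h : 0 < 2 * Ed m ξ * (Ed m ξ + m) := by positivity
    rw [← Complex.ofReal_pow, inv_pow, Real.sq_sqrt h.le]
    exact_mod_cast inv_mul_cancel₀ h.ne'
  rw [Dmat_eq_blocks hm ξ l rfl rfl, Dmat_eq_blocks hm ξ j rfl rfl, u0_conjTranspose]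
  generalize (((Real.sqrt (2 * Ed m ξ * (Ed m ξ + m)))⁻¹ : ℝ) : ℂ) = c at hc ⊢
  have hc' : (2 * Ed m ξ * (Ed m ξ + m) : ℂ)⁻¹ = c ^ 2 :=
    (eq_inv_of_mul_eq_one_left hc).symm
  have hc'' : (2 * Ed m ξ : ℂ)⁻¹ = c ^ 2 * (Ed m ξ + m) := by
    rw [← hc']
    field_simp
  rw [hc', hc'']
  simp only [diracAlpha_eq_blocks, diracBeta_eq_blocks, piRef_eq_blocks, smul_blocks,
    blocks_mul, blocks_sub]
  have hanti := eq_sub_of_add_eq' (xiDotSigma_mul_pauli_add ξ j)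
  congr 1
  · simp only [one_mul, zero_mul, mul_zero, add_zero, zero_add, mul_one, smul_mul_assoc,
      mul_smul_comm, sub_mul, mul_sub, smul_sub, smul_add, smul_smul, smul_zero, sub_zero, hanti]
    push_cast
    match_scalars <;> field_simp <;> ring
  all_goals simp

lemma sum_smul_mul_smul_eq_zero {b : Fin 3 → Fin 3 → ℝ} (hb : ∀ l j, b l j = -b j l)
    (ξ : Fin 3 → ℝ) (G : Matrix (Fin 2) (Fin 2) ℂ) :
    ∑ l, ∑ j, (b l j : ℂ) • (ξ l * ξ j : ℂ) • G = 0 := by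
  have h : ∑ l, ∑ j, (b l j : ℂ) * (ξ l * ξ j) = 0 := by
    rw [← self_eq_neg]
    conv_lhs => rw [Finset.sum_comm]
    simp only [← Finset.sum_neg_distrib]
    refine Finset.sum_congr rfl fun l _ => Finset.sum_congr rfl fun j _ => ?_
    rw [hb j l]
    push_cast
    ring
  simp only [smul_smul, ← Finset.sum_smul, h, zero_smul]

/-- `Σ b_{lj} σ_l σ_j = 2i w·σ` for antisymmetric `b`. -/
lemma sum_pauli_mul_pauli {b : Fin 3 → Fin 3 → ℝ} (hb : ∀ l j, b l j = -b j l) :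
    ∑ l : Fin 3, ∑ j : Fin 3, (b l j : ℂ) • (pauli l * pauli j) =
      (2 * Complex.I) • ∑ k : Fin 3,
        (((2:ℝ)⁻¹ * ∑ l : Fin 3, ∑ j : Fin 3, levi k l j * b l j : ℝ) : ℂ) • pauli k := by
  have hdiag : ∀ l, b l l = 0 := fun l => self_eq_neg.1 (hb l l)
  ext a c
  fin_cases a <;> fin_cases c <;>
    simp [Fin.sum_univ_three, levi, pauli, hdiag, hb 1 0, hb 2 0, hb 2 1] <;>
    ring_nf <;> simp

/-- The magnetic-moment (spin) term of the effective semirelativistic Hamiltonian: for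
an antisymmetric `b`,
`(i/2) Σ_{l,j} b_{lj} π_ref (D_l α_j - (ξ_l/E) β D_j) u₀* π_ref = -(1/(2E)) M`,
where `M` has upper-left `2×2` block `w·σ`, `w_k := (1/2) Σ ε_{klj} b_{lj}`. -/
theorem statement19 (m : ℝ) (hm : 0 < m) (ξ : Fin 3 → ℝ)
    (b : Fin 3 → Fin 3 → ℝ) (hb : ∀ l j, b l j = -b j l) :
    (Complex.I / 2) •
        (∑ l : Fin 3, ∑ j : Fin 3, (b l j : ℂ) •
          (piRef *
            (Dmat m ξ l * diracAlpha j
              - ((ξ l / Ed m ξ : ℝ) : ℂ) • (diracBeta * Dmat m ξ j)) *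
            (u0 m ξ)ᴴ * piRef))
      = ((-(2 * Ed m ξ)⁻¹ : ℝ) : ℂ) •
          Matrix.reindex finSumFinEquiv finSumFinEquiv
            (Matrix.fromBlocks
              (∑ k : Fin 3,
                (((2:ℝ)⁻¹ * ∑ l : Fin 3, ∑ j : Fin 3, levi k l j * b l j : ℝ) : ℂ) •
                  pauli k)
              0 0 (0 : Matrix (Fin 2) (Fin 2) ℂ)) := by
  simp only [piRef_mul_summand_mul_piRef hm, smul_blocks, smul_zero, sum_blocks_zero]
  change _ = _ • blocks _ 0 0 0
  simp only [smul_blocks, smul_zero]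
  congr 1
  simp only [smul_add, Finset.sum_add_distrib, smul_comm _ (2 * Ed m ξ : ℂ)⁻¹, ← Finset.smul_sum,
    sum_pauli_mul_pauli hb, sum_smul_mul_smul_eq_zero hb, add_zero]
  rw [smul_smul, smul_smul]
  congr 1
  push_cast
  linear_combination ((2 * Ed m ξ : ℂ)⁻¹) * Complex.I_mul_I
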